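/- Suppose the null hypothesis holds, i.e. μ is the product of its d marginals. Let ψ_1 be the identity permutation vector and let ψ_2, …, ψ_{B+1} be i.i.d. permutation vectors, each consisting of d−1 independent permutations drawn uniformly from S_n, independent of D. Then the random vector (ψ_1 D, ψ_2 D, …, ψ_{B+1} D) with values in (𝒳^n)^{B+1} is exchangeable: for every permutation σ of {1, …, B+1}, (ψ_{σ(1)} D, …, ψ_{σ(B+1)} D) has the same joint distribution as (ψ_1 D, …, ψ_{B+1} D). -/

import Mathlib

open MeasureTheory ProbabilityTheory Filter
open scoped ENNReal Classical

instance (n : ℕ) : MeasurableSpace (Equiv.Perm (Fin n)) := ⊤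

/-- The uniform distribution on the symmetric group `S_n`. -/
noncomputable def uniformPerm (n : ℕ) : Measure (Equiv.Perm (Fin n)) :=
  (PMF.uniformOfFintype (Equiv.Perm (Fin n))).toMeasure

/-- The action of a permutation vector `ψ = (ψ^1, …, ψ^{d-1})` on a dataset:
the first coordinate is kept fixed and coordinate `j+1` is permuted by `ψ^j`. -/
def permAct {d n : ℕ} {𝒳 : Fin d → Type*} (ψ : Fin (d-1) → Equiv.Perm (Fin n))
    (D : Fin n → ∀ j, 𝒳 j) : Fin n → ∀ j, 𝒳 j :=
  fun i j => if h : j.val = 0 then D i j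
    else D ((ψ ⟨j.val - 1, by have := j.isLt; omega⟩) i) j

/-- The vector `(ψ_1 D, ψ_2 D, …, ψ_{B+1} D)` where `ψ_1` is the identity permutation
vector and `ψ_2, …, ψ_{B+1}` are given permutation vectors. -/
def permVecOfDatasets {d n B : ℕ} {𝒳 : Fin d → Type*}
    (ω : (Fin n → ∀ j, 𝒳 j) × (Fin B → Fin (d-1) → Equiv.Perm (Fin n))) :
    Fin (B+1) → (Fin n → ∀ j, 𝒳 j) :=
  fun i => if h : i.val = 0 then ω.1
    else permAct (ω.2 ⟨i.val - 1, by have := i.isLt; omega⟩) ω.1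

/-- Permuting each coordinate of an i.i.d. sample from a product measure by its own permutation
leaves the law of the sample unchanged. -/
theorem measurePreserving_permute_coordinates {ι κ : Type*} [Fintype ι] [Fintype κ]
    {X : κ → Type*} [∀ j, MeasurableSpace (X j)] (ν : ∀ j, Measure (X j))
    [∀ j, IsProbabilityMeasure (ν j)] (ρ : κ → Equiv.Perm ι) :
    MeasurePreserving (fun (D : ι → ∀ j, X j) i j => D (ρ j i) j)
      (Measure.pi fun _ : ι => Measure.pi ν) (Measure.pi fun _ : ι => Measure.pi ν) := by
  have hcurry : MeasurePreserving (MeasurableEquiv.piCurry fun (_ : ι) j => X j)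
      (Measure.pi fun p : (_ : ι) × κ => ν p.2) (Measure.pi fun _ : ι => Measure.pi ν) := by
    refine ⟨MeasurableEquiv.measurable _, ?_⟩
    have h := Measure.infinitePi_map_piCurry fun (_ : ι) j => ν j
    simpa only [Measure.infinitePi_eq_pi] using h
  have hreindex : MeasurePreserving
      (fun (y : ∀ p : (_ : ι) × κ, X p.2) (p : (_ : ι) × κ) => y ⟨ρ p.2 p.1, p.2⟩)
      (Measure.pi fun p : (_ : ι) × κ => ν p.2) (Measure.pi fun p : (_ : ι) × κ => ν p.2) := by
    refine ⟨by fun_prop, (Measure.pi_eq fun s hs => ?_).symm⟩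
    rw [Measure.map_apply (by fun_prop) (MeasurableSet.univ_pi hs)]
    have hpre : (fun (y : ∀ p : (_ : ι) × κ, X p.2) (p : (_ : ι) × κ) => y ⟨ρ p.2 p.1, p.2⟩) ⁻¹'
        Set.univ.pi s = Set.univ.pi fun p : (_ : ι) × κ => s ⟨(ρ p.2).symm p.1, p.2⟩ := by
      ext y
      simp only [Set.mem_preimage, Set.mem_univ_pi]
      have hshift (i : ι) (j : κ) :
          y ⟨ρ j i, j⟩ ∈ s ⟨(ρ j).symm (ρ j i), j⟩ ↔ y ⟨ρ j i, j⟩ ∈ s ⟨i, j⟩ :=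
        iff_of_eq (congrArg (fun k => y ⟨ρ j i, j⟩ ∈ s ⟨k, j⟩) ((ρ j).symm_apply_apply i))
      refine ⟨fun h ⟨i, j⟩ => ?_, fun h ⟨i, j⟩ => (hshift i j).1 (h ⟨ρ j i, j⟩)⟩
      obtain ⟨i, rfl⟩ := (ρ j).surjective i
      exact (hshift i j).2 (h ⟨i, j⟩)
    rw [hpre, Measure.pi_pi, Fintype.prod_sigma, Fintype.prod_sigma, Finset.prod_comm,
      Finset.prod_comm (s := Finset.univ (α := ι))]
    exact Finset.prod_congr rfl fun j _ =>
      Equiv.prod_comp (ρ j).symm fun i => ν j (s ⟨i, j⟩)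
  exact (hcurry.comp hreindex).comp (hcurry.symm _)

instance isProbabilityMeasure_uniformPerm (n : ℕ) : IsProbabilityMeasure (uniformPerm n) :=
  PMF.toMeasure.isProbabilityMeasure _

theorem measurePreserving_mul_left_uniformPerm {n : ℕ} (g : Equiv.Perm (Fin n)) :
    MeasurePreserving (g * ·) (uniformPerm n) (uniformPerm n) := by
  refine ⟨measurable_from_top, Measure.ext_of_singleton fun a => ?_⟩
  rw [Measure.map_apply measurable_from_top (.of_discrete)]
  have hpre : (g * ·) ⁻¹' {a} = {g⁻¹ * a} := by
    ext x
    simp [eq_inv_mul_iff_mul_eq]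
  rw [hpre, uniformPerm, PMF.toMeasure_apply_singleton _ _ (.of_discrete),
    PMF.toMeasure_apply_singleton _ _ (.of_discrete), PMF.uniformOfFintype_apply,
    PMF.uniformOfFintype_apply]

section permAct

variable {d n B : ℕ} {𝒳 : Fin d → Type*}

theorem permAct_permAct (φ ψ : Fin (d - 1) → Equiv.Perm (Fin n)) (D : Fin n → ∀ j, 𝒳 j) :
    permAct φ (permAct ψ D) = permAct (ψ * φ) D := by
  ext i j
  by_cases h : j.val = 0 <;> simp [permAct, h]

theorem measurePreserving_permAct [∀ j, MeasurableSpace (𝒳 j)] (ν : ∀ j, Measure (𝒳 j))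
    [∀ j, IsProbabilityMeasure (ν j)] (ψ : Fin (d - 1) → Equiv.Perm (Fin n)) :
    MeasurePreserving (permAct ψ)
      (Measure.pi fun _ : Fin n => Measure.pi ν) (Measure.pi fun _ : Fin n => Measure.pi ν) := by
  convert measurePreserving_permute_coordinates (ι := Fin n) ν fun j =>
    if h : j.val = 0 then 1 else ψ ⟨j.val - 1, by have := j.isLt; omega⟩ using 1
  ext D i j
  by_cases h : j.val = 0 <;> simp [permAct, h]

theorem measurable_permAct [∀ j, MeasurableSpace (𝒳 j)] :
    Measurable fun p : (Fin (d - 1) → Equiv.Perm (Fin n)) × (Fin n → ∀ j, 𝒳 j) =>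
      permAct p.1 p.2 := by
  refine measurable_from_prod_countable_right fun ψ => ?_
  refine measurable_pi_lambda _ fun i => measurable_pi_lambda _ fun j => ?_
  by_cases h : j.val = 0 <;> simp only [permAct, h, dite_true, dite_false] <;> fun_prop

theorem measurable_permVecOfDatasets [∀ j, MeasurableSpace (𝒳 j)] :
    Measurable (permVecOfDatasets (d := d) (n := n) (B := B) (𝒳 := 𝒳)) := by
  refine measurable_pi_lambda _ fun i => ?_
  by_cases h : i.val = 0
  · simpa only [permVecOfDatasets, h, dite_true] using measurable_fst
  · simp only [permVecOfDatasets, h, dite_false]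
    exact measurable_permAct.comp (by fun_prop : Measurable fun
      ω : (Fin n → ∀ j, 𝒳 j) × (Fin B → Fin (d - 1) → Equiv.Perm (Fin n)) =>
        (ω.2 ⟨i.val - 1, _⟩, ω.1))

/-- Move the first of `B + 1` permutation vectors into the dataset, and express the others
relative to it. -/
def absorbFirst (p : (Fin n → ∀ j, 𝒳 j) × (Fin (B + 1) → Fin (d - 1) → Equiv.Perm (Fin n))) :
    (Fin n → ∀ j, 𝒳 j) × (Fin B → Fin (d - 1) → Equiv.Perm (Fin n)) :=
  (permAct (p.2 0) p.1, fun k => (p.2 0)⁻¹ * p.2 k.succ)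

theorem permVecOfDatasets_absorbFirst
    (p : (Fin n → ∀ j, 𝒳 j) × (Fin (B + 1) → Fin (d - 1) → Equiv.Perm (Fin n))) :
    permVecOfDatasets (absorbFirst p) = fun i => permAct (p.2 i) p.1 := by
  funext i
  refine Fin.cases ?_ (fun k => ?_) i
  · simp [permVecOfDatasets, absorbFirst]
  · simp [permVecOfDatasets, absorbFirst, permAct_permAct]

theorem measurePreserving_absorbFirst [∀ j, MeasurableSpace (𝒳 j)] (ν : ∀ j, Measure (𝒳 j))
    [∀ j, IsProbabilityMeasure (ν j)] :
    MeasurePreserving (absorbFirst (d := d) (n := n) (B := B) (𝒳 := 𝒳))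
      ((Measure.pi fun _ : Fin n => Measure.pi ν).prod
        (Measure.pi fun _ : Fin (B + 1) => Measure.pi fun _ : Fin (d - 1) => uniformPerm n))
      ((Measure.pi fun _ : Fin n => Measure.pi ν).prod
        (Measure.pi fun _ : Fin B => Measure.pi fun _ : Fin (d - 1) => uniformPerm n)) := by
  set P := Measure.pi fun _ : Fin n => Measure.pi ν
  set Q := Measure.pi fun _ : Fin (d - 1) => uniformPerm n
  have hsplit : MeasurePreserving
      (fun p : (Fin n → ∀ j, 𝒳 j) × (Fin (B + 1) → Fin (d - 1) → Equiv.Perm (Fin n)) =>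
        (p.2 0, (p.1, fun k : Fin B => p.2 k.succ)))
      (P.prod (Measure.pi fun _ => Q)) (Q.prod (P.prod (Measure.pi fun _ => Q))) := by
    have hfin := (MeasurePreserving.id P).prod
      (measurePreserving_piFinSuccAbove (fun _ : Fin (B + 1) => Q) 0)
    have hswap : MeasurePreserving _ (P.prod (Q.prod (Measure.pi fun _ : Fin B => Q))) _ :=
      Measure.measurePreserving_swap
    have hassoc := measurePreserving_prodAssoc Q (Measure.pi fun _ : Fin B => Q) P
    have hswap' := (MeasurePreserving.id Q).prod
      (Measure.measurePreserving_swap (μ := Measure.pi fun _ : Fin B => Q) (ν := P))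
    exact hswap'.comp (hassoc.comp (hswap.comp hfin))
  have htranslate (g : Fin (d - 1) → Equiv.Perm (Fin n)) : MeasurePreserving
      (fun x : Fin B → Fin (d - 1) → Equiv.Perm (Fin n) => fun k => g⁻¹ * x k)
      (Measure.pi fun _ => Q) (Measure.pi fun _ => Q) :=
    measurePreserving_pi _ _ fun _ => measurePreserving_pi _ _ fun l =>
      measurePreserving_mul_left_uniformPerm (g⁻¹ l)
  have hskew := (MeasurePreserving.id Q).skew_product
    (μc := P.prod (Measure.pi fun _ : Fin B => Q)) (μd := P.prod (Measure.pi fun _ : Fin B => Q))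
    (g := fun g x => (permAct g x.1, fun k => g⁻¹ * x.2 k))
    (measurable_from_prod_countable_right fun g =>
      ((measurePreserving_permAct ν g).prod (htranslate g)).measurable)
    (ae_of_all _ fun g => ((measurePreserving_permAct ν g).prod (htranslate g)).map_eq)
  exact measurePreserving_snd.comp (hskew.comp hsplit)

end permAct

/-- **Exchangeability of `(ψ_1 D, …, ψ_{B+1} D)` under the null hypothesis.**
If the law `μ` of each observation is the product of its `d` marginals, `ψ_1` is the
identity permutation vector and `ψ_2, …, ψ_{B+1}` are i.i.d. permutation vectors (each
consisting of `d-1` independent uniform permutations), independent of the i.i.d.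
sample `D`, then for every permutation `σ` of `{1, …, B+1}` the vector
`(ψ_{σ(1)} D, …, ψ_{σ(B+1)} D)` has the same joint distribution as
`(ψ_1 D, …, ψ_{B+1} D)`. -/
theorem permuted_datasets_exchangeable
    {d n B : ℕ} (hd : 2 ≤ d)
    (𝒳 : Fin d → Type*) [∀ j, MeasurableSpace (𝒳 j)]
    (μ : Measure (∀ j, 𝒳 j)) [IsProbabilityMeasure μ]
    (hnull : μ = Measure.pi (fun j => μ.map (fun x => x j)))
    (σ : Equiv.Perm (Fin (B+1))) :
    ((Measure.pi fun _ : Fin n => μ).prod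
        (Measure.pi fun _ : Fin B => Measure.pi fun _ : Fin (d-1) => uniformPerm n)).map
      (fun ω => fun i => permVecOfDatasets ω (σ i))
    = ((Measure.pi fun _ : Fin n => μ).prod
        (Measure.pi fun _ : Fin B => Measure.pi fun _ : Fin (d-1) => uniformPerm n)).map
      permVecOfDatasets := by
  have hmarginal (j : Fin d) : IsProbabilityMeasure (μ.map fun x => x j) :=
    Measure.isProbabilityMeasure_map (measurable_pi_apply j).aemeasurable
  have habsorb := measurePreserving_absorbFirst (n := n) (B := B) fun j => μ.map fun x => x j
  rw [← hnull] at habsorb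
  have hvec := measurable_permVecOfDatasets (d := d) (n := n) (B := B) (𝒳 := 𝒳)
  have hvecσ : Measurable fun ω i => permVecOfDatasets (d := d) (n := n) (𝒳 := 𝒳) ω (σ i) := by
    fun_prop
  have hreindex := (MeasurePreserving.id (Measure.pi fun _ : Fin n => μ)).prod
    (measurePreserving_arrowCongr'
      (fun _ : Fin (B + 1) => Measure.pi fun _ : Fin (d - 1) => uniformPerm n)
      (fun _ => Measure.pi fun _ => uniformPerm n) σ.symm (MeasurableEquiv.refl _)
      fun _ => MeasurePreserving.id _)
  rw [← habsorb.map_eq, Measure.map_map hvecσ habsorb.measurable,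
    Measure.map_map hvec habsorb.measurable]
  conv_rhs => rw [← hreindex.map_eq]
  rw [Measure.map_map (hvec.comp habsorb.measurable) hreindex.measurable]
  congr 1
  funext p
  simp only [Function.comp_def, permVecOfDatasets_absorbFirst]
  rfl
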